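/- For every unit vector v the series Λ(v) = Σ_{j=0}^∞ 2^{−j−1} log‖Q(Φʲ(v))‖ converges absolutely, and Λ satisfies the uniform bounds log q ≤ Λ(v) ≤ log Q_max for all unit v, where Q_max = sup_{‖u‖=1} ‖Q(u)‖ (which is finite). -/

import Mathlib

theorem hasSum_one_half_pow_succ : HasSum (fun j : ℕ => ((1 : ℝ) / 2) ^ (j + 1)) 1 := by
  convert hasSum_geometric_two' 1 using 2 with j
  rw [pow_succ, div_pow, one_pow]
  ring

/-- A dyadically weighted series of terms lying in `[a, b]` converges absolutely, and its sum
lies in `[a, b]`. -/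
theorem dyadic_average_mem_Icc {f : ℕ → ℝ} {a b : ℝ} (hf : ∀ j, f j ∈ Set.Icc a b) :
    (Summable fun j : ℕ => |((1 : ℝ) / 2) ^ (j + 1) * f j|) ∧
      (∑' j : ℕ, ((1 : ℝ) / 2) ^ (j + 1) * f j) ∈ Set.Icc a b := by
  have hs : Summable fun j : ℕ => |((1 : ℝ) / 2) ^ (j + 1) * f j| := by
    refine Summable.of_nonneg_of_le (fun j => abs_nonneg _) (fun j => ?_)
      (hasSum_one_half_pow_succ.summable.mul_right (max |a| |b|))
    rw [abs_mul, abs_of_nonneg (by positivity : (0 : ℝ) ≤ (1 / 2) ^ (j + 1))]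
    gcongr
    exact abs_le_max_abs_abs (hf j).1 (hf j).2
  have hsum := hs.of_abs.hasSum
  have ha := hasSum_one_half_pow_succ.mul_right a
  have hb := hasSum_one_half_pow_succ.mul_right b
  rw [one_mul] at ha hb
  exact ⟨hs,
    hasSum_le (fun j => mul_le_mul_of_nonneg_left (hf j).1 (by positivity)) ha hsum,
    hasSum_le (fun j => mul_le_mul_of_nonneg_left (hf j).2 (by positivity)) hsum hb⟩


/-- for every unit vector `v`, the series
`Λ(v) = ∑_{j=0}^∞ 2^{-j-1} log‖Q(Φ^j(v))‖` converges absolutely, and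
`log q ≤ Λ(v) ≤ log Q_max` where `Q_max = sup_{‖u‖=1} ‖Q(u)‖` is finite
(i.e. it is a least upper bound in `ℝ`). -/
theorem stmt5 (n : ℕ) (hn : 1 ≤ n)
    (J : EuclideanSpace ℝ (Fin n) ≃L[ℝ] EuclideanSpace ℝ (Fin n))
    (H : EuclideanSpace ℝ (Fin n) →L[ℝ] EuclideanSpace ℝ (Fin n) →L[ℝ]
      EuclideanSpace ℝ (Fin n))
    (hHsymm : ∀ u v, H u v = H v u)
    (Q : EuclideanSpace ℝ (Fin n) → EuclideanSpace ℝ (Fin n))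
    (hQ : ∀ v, Q v = ((1 : ℝ) / 2) • J.symm (H v v))
    (q : ℝ) (hq : 0 < q) (hQlow : ∀ v, ‖v‖ = 1 → q ≤ ‖Q v‖)
    (Φ : EuclideanSpace ℝ (Fin n) → EuclideanSpace ℝ (Fin n))
    (hΦ : ∀ v, Φ v = -(‖Q v‖⁻¹ • Q v)) :
    ∃ Qmax : ℝ,
      IsLUB ((fun u => ‖Q u‖) '' {u : EuclideanSpace ℝ (Fin n) | ‖u‖ = 1}) Qmax ∧
      ∀ v : EuclideanSpace ℝ (Fin n), ‖v‖ = 1 →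
        (Summable fun j : ℕ => |((1 : ℝ) / 2) ^ (j + 1) * Real.log ‖Q (Φ^[j] v)‖|) ∧
        Real.log q ≤ ∑' j : ℕ, ((1 : ℝ) / 2) ^ (j + 1) * Real.log ‖Q (Φ^[j] v)‖ ∧
        (∑' j : ℕ, ((1 : ℝ) / 2) ^ (j + 1) * Real.log ‖Q (Φ^[j] v)‖) ≤ Real.log Qmax := by
  have hcont : Continuous fun u => ‖Q u‖ := by
    rw [funext hQ]
    fun_prop
  have hbdd : BddAbove ((fun u => ‖Q u‖) '' {u : EuclideanSpace ℝ (Fin n) | ‖u‖ = 1}) := by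
    have hsphere : {u : EuclideanSpace ℝ (Fin n) | ‖u‖ = 1} = Metric.sphere 0 1 := by
      ext u
      simp
    rw [hsphere]
    exact (isCompact_sphere _ _).bddAbove_image hcont.continuousOn
  have hne : ((fun u => ‖Q u‖) '' {u : EuclideanSpace ℝ (Fin n) | ‖u‖ = 1}).Nonempty :=
    ⟨_, EuclideanSpace.single ⟨0, hn⟩ 1, by simp, rfl⟩
  have hlub := isLUB_csSup hne hbdd
  refine ⟨_, hlub, fun v hv => ?_⟩
  have hΦnorm (u : EuclideanSpace ℝ (Fin n)) (hu : ‖u‖ = 1) : ‖Φ u‖ = 1 := by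
    have hpos : 0 < ‖Q u‖ := hq.trans_le (hQlow u hu)
    rw [hΦ, norm_neg, norm_smul, norm_inv, norm_norm, inv_mul_cancel₀ hpos.ne']
  have horbit (j : ℕ) : ‖Φ^[j] v‖ = 1 := by
    induction j with
    | zero => exact hv
    | succ j ih =>
      rw [Function.iterate_succ_apply']
      exact hΦnorm _ ih
  refine dyadic_average_mem_Icc fun j => ?_
  have hlow := hQlow _ (horbit j)
  exact ⟨Real.log_le_log hq hlow,
    Real.log_le_log (hq.trans_le hlow) (hlub.1 ⟨_, horbit j, rfl⟩)⟩
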